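/- For c > 0, real α with α > 0, and complex z with |arg z| < π/2, the Cahen–Mellin integral holds: (1/(2πi)) ∫_{c−i∞}^{c+i∞} Γ(s+α) z^{−s} ds = z^α e^{−z}, where the integral is taken along the vertical line Re(s) = c with c + α > 0. -/

import Mathlib

open Real Complex MeasureTheory

open Set Filter Topology

theorem integrableOn_cpow_mul_cexp_neg_mul_Ioi {a w : ℂ} (ha : 0 < a.re) (hw : 0 < w.re) :
    IntegrableOn (fun t : ℝ ↦ (t : ℂ) ^ (a - 1) * cexp (-(w * t))) (Ioi 0) := by
  have h : IntegrableOn (fun t : ℝ ↦ t ^ (a.re - 1) * rexp (-w.re * t)) (Ioi 0) := by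
    simpa using integrableOn_rpow_mul_exp_neg_mul_rpow (p := 1) (s := a.re - 1) (by linarith)
      one_pos hw
  refine Integrable.mono' h ?_ ?_
  · refine ContinuousOn.aestronglyMeasurable (fun t ht ↦ ContinuousAt.continuousWithinAt ?_)
      measurableSet_Ioi
    have : (t : ℂ) ∈ slitPlane := by simpa using (show 0 < t from ht)
    fun_prop (disch := assumption)
  · refine (ae_restrict_iff' measurableSet_Ioi).2 (ae_of_all _ fun t ht ↦ ?_)
    rw [norm_mul, norm_cpow_eq_rpow_re_of_pos ht, norm_exp]
    simp

theorem differentiableAt_integral_cpow_mul_cexp_neg_mul_Ioi {a w : ℂ} (ha : 0 < a.re) (hw : 0 < w.re) :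
    DifferentiableAt ℂ (fun w : ℂ ↦ ∫ t : ℝ in Ioi 0, (t : ℂ) ^ (a - 1) * cexp (-(w * t))) w := by
  have hs : {v : ℂ | w.re / 2 < v.re} ∈ 𝓝 w :=
    (isOpen_lt continuous_const continuous_re).mem_nhds (by simp; linarith)
  have hb : IntegrableOn (fun t : ℝ ↦ t ^ a.re * rexp (-(w.re / 2) * t)) (Ioi 0) := by
    simpa using integrableOn_rpow_mul_exp_neg_mul_rpow (p := 1) (s := a.re) (by linarith) one_pos
      (half_pos hw)
  refine (hasDerivAt_integral_of_dominated_loc_of_deriv_le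
    (μ := volume.restrict (Ioi 0))
    (F := fun v (t : ℝ) ↦ (t : ℂ) ^ (a - 1) * cexp (-(v * t)))
    (F' := fun v t ↦ (t : ℂ) ^ (a - 1) * (cexp (-(v * t)) * (-t))) hs
    ?_ (integrableOn_cpow_mul_cexp_neg_mul_Ioi ha hw) ?_ ?_ hb ?_).2.differentiableAt
  · filter_upwards [hs] with v hv
    exact (integrableOn_cpow_mul_cexp_neg_mul_Ioi ha
      ((half_pos hw).trans hv)).aestronglyMeasurable
  · simp only [← mul_assoc]
    exact (integrableOn_cpow_mul_cexp_neg_mul_Ioi ha hw).aestronglyMeasurable.mul (by fun_prop)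
  · refine (ae_restrict_iff' measurableSet_Ioi).2 (ae_of_all _ fun t ht v hv ↦ ?_)
    have ht : 0 < t := ht
    have hv : w.re / 2 < v.re := hv
    have : t ^ a.re = t ^ (a.re - 1) * t := by rw [rpow_sub_one ht.ne']; field_simp
    rw [norm_mul, norm_mul, norm_cpow_eq_rpow_re_of_pos ht, norm_exp, norm_neg, norm_real,
      norm_of_nonneg ht.le, this, mul_assoc, mul_comm t]
    simp
    gcongr
  · refine ae_of_all _ fun t v hv ↦ HasDerivAt.const_mul _ (HasDerivAt.cexp ?_)
    simpa using! ((hasDerivAt_id v).mul_const (t : ℂ)).neg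

theorem integral_cpow_mul_cexp_neg_mul_Ioi {a w : ℂ} (ha : 0 < a.re) (hw : 0 < w.re) :
    ∫ t : ℝ in Ioi 0, (t : ℂ) ^ (a - 1) * cexp (-(w * t)) = w ^ (-a) * Complex.Gamma a := by
  have hU : IsOpen {v : ℂ | 0 < v.re} := isOpen_lt continuous_const continuous_re
  have hl : AnalyticOnNhd ℂ
      (fun v : ℂ ↦ ∫ t : ℝ in Ioi 0, (t : ℂ) ^ (a - 1) * cexp (-(v * t))) {v | 0 < v.re} :=
    DifferentiableOn.analyticOnNhd (fun v hv ↦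
      (differentiableAt_integral_cpow_mul_cexp_neg_mul_Ioi ha hv).differentiableWithinAt) hU
  have hr : AnalyticOnNhd ℂ (fun v : ℂ ↦ v ^ (-a) * Complex.Gamma a) {v | 0 < v.re} := by
    refine DifferentiableOn.analyticOnNhd (fun v hv ↦ DifferentiableAt.differentiableWithinAt ?_) hU
    have : v ∈ slitPlane := Or.inl hv
    fun_prop (disch := assumption)
  refine hl.eqOn_of_preconnected_of_frequently_eq hr (z₀ := 1)
    (convex_halfSpace_re_gt 0).isPreconnected (by simp) ?_ hw
  have ht : Tendsto (fun r : ℝ ↦ (r : ℂ)) (𝓝[≠] 1) (𝓝[≠] 1) := by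
    refine tendsto_nhdsWithin_iff.2 ⟨?_, ?_⟩
    · exact (continuous_ofReal.tendsto' 1 1 (by simp)).mono_left nhdsWithin_le_nhds
    · filter_upwards [self_mem_nhdsWithin] with r hr using by simpa using hr
  refine ht.frequently (Eventually.frequently ?_)
  filter_upwards [nhdsWithin_le_nhds (Ioi_mem_nhds (zero_lt_one (α := ℝ)))] with r hr
  rw [Complex.integral_cpow_mul_exp_neg_mul_Ioi ha hr, cpow_neg, one_div, inv_cpow]
  rw [arg_ofReal_of_nonneg (le_of_lt hr)]
  exact pi_pos.ne

theorem norm_Gamma_add_mul_I_le {σ θ : ℝ} (hσ : 0 < σ) (hθ : |θ| < π / 2) (t : ℝ) :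
    ‖Complex.Gamma (σ + t * I)‖ ≤
      rexp (-(θ * t)) * ∫ x : ℝ in Ioi 0, x ^ (σ - 1) * rexp (-(Real.cos θ * x)) := by
  have hw : (cexp (θ * I)).re = Real.cos θ := by simp [exp_ofReal_mul_I_re]
  have hlog : Complex.log (cexp (θ * I)) = θ * I := by
    have := abs_lt.1 hθ
    apply Complex.log_exp <;> simp <;> linarith [pi_pos]
  have h := integral_cpow_mul_cexp_neg_mul_Ioi (a := σ + t * I) (w := cexp (θ * I)) (by simpa)
    (hw ▸ Real.cos_pos_of_mem_Ioo (abs_lt.1 hθ))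
  have h' := congrArg norm h
  rw [norm_mul, cpow_def_of_ne_zero (Complex.exp_ne_zero _), hlog, norm_exp] at h'
  have hre : ((θ : ℂ) * I * -(σ + t * I)).re = θ * t := by simp
  rw [hre] at h'
  rw [Real.exp_neg, ← div_eq_inv_mul, le_div_iff₀ (Real.exp_pos _), mul_comm, ← h']
  refine (norm_integral_le_integral_norm _).trans_eq
    (setIntegral_congr_fun measurableSet_Ioi fun x hx ↦ ?_)
  rw [norm_mul, norm_cpow_eq_rpow_re_of_pos hx, norm_exp]
  simp [exp_ofReal_mul_I_re]

theorem integrable_exp_neg_mul_abs {k : ℝ} (hk : 0 < k) :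
    Integrable (fun t : ℝ ↦ rexp (-(k * |t|))) := by
  rw [← integrableOn_univ, ← Iic_union_Ioi (a := (0 : ℝ))]
  refine IntegrableOn.union ?_ ?_
  · refine (integrableOn_exp_mul_Iic hk 0).congr_fun (fun t ht ↦ ?_) measurableSet_Iic
    simp [abs_of_nonpos (show t ≤ 0 from ht)]
  · refine (integrableOn_exp_mul_Ioi (neg_lt_zero.2 hk) 0).congr_fun (fun t ht ↦ ?_)
      measurableSet_Ioi
    simp [abs_of_pos (show 0 < t from ht)]

theorem integrable_cpow_neg_mul_Gamma {σ : ℝ} {z : ℂ} (hσ : 0 < σ) (hz₀ : z ≠ 0)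
    (hz : |z.arg| < π / 2) :
    Integrable (fun t : ℝ ↦ z ^ (-(σ + t * I)) * Complex.Gamma (σ + t * I)) := by
  obtain ⟨θ, hzθ, hθ⟩ := exists_between hz
  have hθ₀ : 0 ≤ θ := (abs_nonneg _).trans hzθ.le
  set C : ℝ := ∫ x : ℝ in Ioi 0, x ^ (σ - 1) * rexp (-(Real.cos θ * x)) with hC
  have hbound (t : ℝ) : ‖Complex.Gamma (σ + t * I)‖ ≤ rexp (-(θ * |t|)) * C := by
    rcases abs_cases t with ⟨h, -⟩ | ⟨h, -⟩
    · rw [h]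
      exact norm_Gamma_add_mul_I_le hσ (by rwa [abs_of_nonneg hθ₀]) t
    · have := norm_Gamma_add_mul_I_le (θ := -θ) hσ (by rwa [abs_neg, abs_of_nonneg hθ₀]) t
      rwa [Real.cos_neg, ← hC, neg_mul_comm, ← h] at this
  refine ((integrable_exp_neg_mul_abs (sub_pos.2 hzθ)).const_mul (‖z‖ ^ (-σ) * C)).mono'
    (Continuous.aestronglyMeasurable (continuous_iff_continuousAt.2 fun t ↦ ?_))
    (ae_of_all _ fun t ↦ ?_)
  · have hG : ContinuousAt Complex.Gamma (σ + t * I) :=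
      (differentiableAt_Gamma _ fun m h ↦ by
        have := congrArg re h
        simp at this
        linarith [(Nat.cast_nonneg m : (0 : ℝ) ≤ m)]).continuousAt
    refine ContinuousAt.mul ?_ (ContinuousAt.comp (f := fun t : ℝ ↦ (σ + t * I : ℂ)) hG
      (by fun_prop))
    exact ContinuousAt.const_cpow (by fun_prop) (Or.inl hz₀)
  · have harg : z.arg * t ≤ |z.arg| * |t| := (le_abs_self _).trans_eq (abs_mul _ _)
    calc ‖z ^ (-(σ + t * I)) * Complex.Gamma (σ + t * I)‖
        = ‖z‖ ^ (-σ) * rexp (z.arg * t) * ‖Complex.Gamma (σ + t * I)‖ := by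
          rw [norm_mul, norm_cpow_of_ne_zero hz₀]
          simp [Real.exp_neg]
      _ ≤ ‖z‖ ^ (-σ) * rexp (|z.arg| * |t|) * (rexp (-(θ * |t|)) * C) := by
          gcongr
          exact hbound t
      _ = ‖z‖ ^ (-σ) * C * rexp (-((θ - |z.arg|) * |t|)) := by
          rw [show -((θ - |z.arg|) * |t|) = |z.arg| * |t| + -(θ * |t|) by ring, Real.exp_add]
          ring

theorem cahen_mellin_integral (c α : ℝ) (z : ℂ) (hc : 0 < c) (hα : 0 < α)
    (hz : |z.arg| < π / 2) :
    (1 / (2 * (π : ℂ))) *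
        ∫ t : ℝ, Complex.Gamma ((c : ℂ) + t * Complex.I + α) *
          z ^ (-((c : ℂ) + t * Complex.I))
      = z ^ (α : ℂ) * Complex.exp (-z) := by
  rcases eq_or_ne z 0 with rfl | hz₀
  · have (t : ℝ) : -((c : ℂ) + t * I) ≠ 0 := fun h ↦ by
      have := congrArg re h
      simp at this
      linarith
    simp only [zero_cpow (this _), zero_cpow (ofReal_ne_zero.2 hα.ne')]
    simp
  have hre : 0 < z.re := (abs_arg_lt_pi_div_two_iff.1 hz).resolve_right hz₀
  have hσ : 0 < c + α := by positivity
  have hM {s : ℂ} (hs : 0 < s.re) :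
      mellin (fun x : ℝ ↦ cexp (-(z * x))) s = z ^ (-s) * Complex.Gamma s :=
    integral_cpow_mul_cexp_neg_mul_Ioi hs hre
  have hM' (t : ℝ) := hM (s := ↑(c + α) + t * I) (by simpa using hσ)
  have h := mellinInv_mellin_eq (c + α) (fun x : ℝ ↦ cexp (-(z * x))) one_pos
    (integrableOn_cpow_mul_cexp_neg_mul_Ioi (by simpa using hσ) hre)
    (by
      unfold VerticalIntegrable
      simp only [hM']
      exact integrable_cpow_neg_mul_Gamma hσ hz₀ hz)
    (by fun_prop)
  simp only [mellinInv, hM', ofReal_one, one_cpow, one_smul, mul_one] at h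
  rw [← h, real_smul, mul_left_comm, ← integral_const_mul (z ^ (α : ℂ))]
  push_cast
  congr 1
  refine integral_congr_ae (ae_of_all _ fun t ↦ ?_)
  beta_reduce
  rw [← mul_assoc, ← cpow_add _ _ hz₀, mul_comm]
  congr 2 <;> ring_nf
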